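/- Let q be a prime power, n a positive integer, 0 ≤ l ≤ n−2, and 0 ≤ m ≤ ⌊(n−l−1)/2⌋ + 1. Let A = A(a_1, …, a_{n−l−1}) where a_i = 0 for all i ≤ m and a_i ≠ 0 for all i > m. Then the conjugacy class of A in U(n,q) has size exactly q^{(n−l−1)(n−l−2)/2 − m(m−1)/2}. Moreover, two distinct such matrices (for the same l and m) are not conjugate in U(n,q). -/

import Mathlib

/-- A matrix is lower unitriangular: all diagonal entries are `1` and all entries
above the diagonal are `0`. -/
def IsUnitriangular {n : ℕ} {F : Type*} [Field F] (A : Matrix (Fin n) (Fin n) F) : Prop :=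
  (∀ i, A i i = 1) ∧ ∀ i j : Fin n, i < j → A i j = 0

/-- The matrix `A(a_1, …, a_{n-l-1}) = I + ∑_{i=1}^{n-l-1} a_i e_{l+1+i,i}` (with
`1`-based indices), where `a t` (for `0 ≤ t < n - l - 1`) encodes the paper's `a_{t+1}`. -/
def canonMatrix {F : Type*} [Field F] (n l : ℕ) (a : ℕ → F) :
    Matrix (Fin n) (Fin n) F :=
  fun i j => if i = j then 1 else if (i : ℕ) = (j : ℕ) + l + 1 then a (j : ℕ) else 0

namespace pPowerPaper

open Finset

variable {F : Type*} [Field F]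

/-- The positions below the `k`-th subdiagonal and in rows `m + k` and later. -/
def Below (k m i j : ℕ) : Prop := m + k ≤ i ∧ j + k < i

instance (k m i j : ℕ) : Decidable (Below k m i j) :=
  inferInstanceAs (Decidable (_ ∧ _))

/-- The entries of a unitriangular matrix conjugating `I + X` to `I + X + y`, where
`X` has entries `a t` at `(t + k, t)` with `a t = 0` for `t < m`. The entry at `(i, j)` is
determined by the entries closer to the diagonal and those at `(i - k, j - k)`. -/
noncomputable def conjugator (n k m : ℕ) (a : ℕ → F) (y : ℕ → ℕ → F) (hk : 0 < k)
    (i j : ℕ) : F :=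
  if _hij : i < j then 0 else if _hne : i = j then 1 else
  if _hj : j < m then
    if m ≤ i ∧ i + k < n then
      (∑ s : Ioc (j + k) (i + k), conjugator n k m a y hk (i + k) s * y s j) / a i
    else 0
  else if _hmj : m + k ≤ j then
    (a (i - k) * conjugator n k m a y hk (i - k) (j - k)
      - ∑ s : Ioc j i, conjugator n k m a y hk i s * y s (j - k)) / a (j - k)
  else 0
termination_by (i - j, i)
decreasing_by
  · have := mem_Ioc.1 s.2
    exact Prod.Lex.left _ _ (by omega)
  · have e : i - k - (j - k) = i - j := by omega
    rw [e]
    exact Prod.Lex.right _ (by omega)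
  · have := mem_Ioc.1 s.2
    exact Prod.Lex.left _ _ (by omega)

section conjugator

variable {n k m : ℕ} {a : ℕ → F} {y : ℕ → ℕ → F} (hk : 0 < k)

theorem conjugator_of_lt {i j : ℕ} (h : i < j) : conjugator n k m a y hk i j = 0 := by
  rw [conjugator, dif_pos h]

theorem conjugator_self (i : ℕ) : conjugator n k m a y hk i i = 1 := by
  rw [conjugator, dif_neg (lt_irrefl i), dif_pos rfl]

theorem conjugator_mul_of_lt {i j : ℕ} (hj : j < m) (hm : m + k ≤ i) (hi : i < n)
    (ha : a (i - k) ≠ 0) :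
    a (i - k) * conjugator n k m a y hk (i - k) j
      = ∑ s ∈ Ioc (j + k) i, conjugator n k m a y hk i s * y s j := by
  rw [conjugator, dif_neg (by omega), dif_neg (by omega), dif_pos hj, if_pos (by omega),
    mul_div_cancel₀ _ ha, Nat.sub_add_cancel (by omega)]
  exact sum_coe_sort (Ioc (j + k) i) fun s => conjugator n k m a y hk i s * y s j

theorem conjugator_mul_of_le {i j : ℕ} (hj : m ≤ j) (hij : j + k < i) (ha : a j ≠ 0) :
    conjugator n k m a y hk i (j + k) * a j = a (i - k) * conjugator n k m a y hk (i - k) j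
      - ∑ s ∈ Ioc (j + k) i, conjugator n k m a y hk i s * y s j := by
  rw [conjugator, dif_neg (by omega), dif_neg (by omega), dif_neg (by omega),
    dif_pos (by omega)]
  simp only [Nat.add_sub_cancel]
  rw [div_mul_cancel₀ _ ha]
  congr 1
  exact sum_coe_sort (Ioc (j + k) i) fun s => conjugator n k m a y hk i s * y s j

end conjugator

theorem _root_.IsUnitriangular.det_eq_one {n : ℕ} {C : Matrix (Fin n) (Fin n) F}
    (hC : IsUnitriangular C) : C.det = 1 := by
  rw [Matrix.det_of_isLowerTriangular C fun i j h => hC.2 i j h]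
  exact prod_eq_one fun i _ => hC.1 i

theorem _root_.IsUnitriangular.inv_mul_mul_eq_iff {n : ℕ} {A B C : Matrix (Fin n) (Fin n) F}
    (hC : IsUnitriangular C) : C⁻¹ * A * C = B ↔ A * C = C * B := by
  have hu : IsUnit C.det := by rw [hC.det_eq_one]; exact isUnit_one
  rw [Matrix.mul_assoc]
  constructor
  · rintro rfl
    rw [Matrix.mul_nonsing_inv_cancel_left _ _ hu]
  · intro h
    rw [h, Matrix.nonsing_inv_mul_cancel_left _ _ hu]

/-- The part of `canonMatrix` below the diagonal. -/
def subdiagonal (n l : ℕ) (a : ℕ → F) : Matrix (Fin n) (Fin n) F :=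
  fun i j => if (i : ℕ) = (j : ℕ) + l + 1 then a j else 0

theorem canonMatrix_eq (n l : ℕ) (a : ℕ → F) :
    canonMatrix n l a = 1 + subdiagonal n l a := by
  ext i j
  by_cases h : i = j
  · subst h
    simp [canonMatrix, subdiagonal, Nat.add_assoc]
  · simp [canonMatrix, subdiagonal, h]

theorem subdiagonal_mul_apply (n l : ℕ) (a : ℕ → F) (C : Matrix (Fin n) (Fin n) F)
    (i j : Fin n) :
    (subdiagonal n l a * C) i j =
      if l + 1 ≤ (i : ℕ) then a (i - (l + 1)) * C ⟨i - (l + 1), by omega⟩ j else 0 := by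
  rw [Matrix.mul_apply]
  split_ifs with h
  · rw [sum_eq_single ⟨i - (l + 1), by omega⟩]
    · rw [subdiagonal, if_pos (by simp only []; omega)]
    · intro s _ hs
      rw [subdiagonal, if_neg (fun h' => hs (Fin.ext (by simp only []; omega))), zero_mul]
    · simp
  · refine sum_eq_zero fun s _ => ?_
    rw [subdiagonal, if_neg (by omega), zero_mul]

theorem mul_subdiagonal_apply (n l : ℕ) (a : ℕ → F) (C : Matrix (Fin n) (Fin n) F)
    (i j : Fin n) :
    (C * subdiagonal n l a) i j =
      if h : (j : ℕ) + (l + 1) < n then C i ⟨j + (l + 1), h⟩ * a j else 0 := by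
  rw [Matrix.mul_apply]
  split_ifs with h
  · rw [sum_eq_single ⟨j + (l + 1), h⟩]
    · rw [subdiagonal, if_pos (by simp only []; omega)]
    · intro s _ hs
      rw [subdiagonal, if_neg (fun h' => hs (Fin.ext (by simp only []; omega))), mul_zero]
    · simp
  · refine sum_eq_zero fun s _ => ?_
    rw [subdiagonal, if_neg (by omega), mul_zero]

/-- The commutator of `subdiagonal` with a unitriangular matrix vanishes off `Below`. -/
theorem commutator_apply_eq_zero {n l m : ℕ} {a : ℕ → F} (ha : ∀ t, t < n - l - 1 → t < m → a t = 0)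
    {C : Matrix (Fin n) (Fin n) F} (hC : IsUnitriangular C) {i j : Fin n}
    (hij : ¬ Below (l + 1) m i j) :
    (subdiagonal n l a * C) i j = (C * subdiagonal n l a) i j := by
  rw [subdiagonal_mul_apply, mul_subdiagonal_apply]
  rcases lt_trichotomy (i : ℕ) (j + (l + 1)) with h | h | h
  · have h1 : ∀ hi : l + 1 ≤ (i : ℕ), C ⟨i - (l + 1), by omega⟩ j = 0 := fun hi =>
      hC.2 _ _ (Fin.lt_def.2 (by simp only []; omega))
    have h2 : ∀ hj : (j : ℕ) + (l + 1) < n, C i ⟨j + (l + 1), hj⟩ = 0 := fun hj =>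
      hC.2 _ _ (Fin.lt_def.2 h)
    split_ifs with hi hj hj <;> simp_all
  · have e1 : (⟨i - (l + 1), by omega⟩ : Fin n) = j := Fin.ext (by simp only []; omega)
    have e2 : (⟨j + (l + 1), by omega⟩ : Fin n) = i := Fin.ext (by simp only []; omega)
    have e3 : (i : ℕ) - (l + 1) = j := by omega
    rw [if_pos (by omega), dif_pos (by omega), e1, e2, hC.1, hC.1, e3, one_mul, mul_one]
  · have him : (i : ℕ) < m + (l + 1) := by
      by_contra h'
      exact hij ⟨by omega, h⟩
    rw [if_pos (by omega), dif_pos (by omega), ha _ (by omega) (by omega),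
      ha j (by omega) (by omega), zero_mul, mul_zero]

/-- Left division by a unitriangular matrix preserves vanishing off `Below`. -/
theorem apply_eq_zero_of_unitriangular_mul {n k m : ℕ} {C W : Matrix (Fin n) (Fin n) F}
    (hC : IsUnitriangular C) (h : ∀ i j : Fin n, ¬ Below k m i j → (C * W) i j = 0) (i j : Fin n)
    (hij : ¬ Below k m i j) : W i j = 0 := by
  induction i using WellFoundedLT.induction with
  | ind i ih =>
    have := h i j hij
    rw [Matrix.mul_apply, sum_eq_single i, hC.1, one_mul] at this
    · exact this
    · intro s _ hs
      rcases lt_or_gt_of_ne hs with hs | hs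
      · rw [ih s hs, mul_zero]
        rintro ⟨h1, h2⟩
        exact hij ⟨by omega, by omega⟩
      · rw [hC.2 _ _ hs, zero_mul]
    · simp

theorem exists_conjugator {n l m : ℕ} {a : ℕ → F}
    (ha : ∀ t, t < n - l - 1 → (t < m → a t = 0) ∧ (m ≤ t → a t ≠ 0))
    {W : Matrix (Fin n) (Fin n) F} (hW : ∀ i j : Fin n, ¬ Below (l + 1) m i j → W i j = 0) :
    ∃ C : Matrix (Fin n) (Fin n) F, IsUnitriangular C ∧
      subdiagonal n l a * C = C * (subdiagonal n l a + W) := by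
  let y : ℕ → ℕ → F := fun i j => if h : i < n ∧ j < n then W ⟨i, h.1⟩ ⟨j, h.2⟩ else 0
  have hy : ∀ i j : Fin n, W i j = y i j := fun i j => by simp [y]
  let c := conjugator n (l + 1) m a y l.succ_pos
  let C : Matrix (Fin n) (Fin n) F := .of fun i j => c i j
  have hC : IsUnitriangular C :=
    ⟨fun i => conjugator_self _ _, fun i j h => conjugator_of_lt _ h⟩
  refine ⟨C, hC, ?_⟩
  have hsum : ∀ i j : Fin n, (C * W) i j =
      ∑ s ∈ Ioc ((j : ℕ) + (l + 1)) i, c i s * y s j := by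
    intro i j
    rw [Matrix.mul_apply]
    simp only [hy, C, Matrix.of_apply]
    rw [Fin.sum_univ_eq_sum_range (fun s => c i s * y s j) n]
    symm
    refine sum_subset (fun s hs => ?_) (fun s hs hs' => ?_)
    · rw [mem_Ioc] at hs
      exact mem_range.2 (by omega)
    · rw [mem_range] at hs
      rw [mem_Ioc] at hs'
      by_cases h : (i : ℕ) < s
      · rw [show c i s = 0 from conjugator_of_lt _ h, zero_mul]
      · rw [← hy ⟨s, hs⟩ j, hW _ _ (fun hb => hs' ⟨hb.2, by omega⟩), mul_zero]
  ext i j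
  rw [Matrix.mul_add, Matrix.add_apply]
  by_cases hb : Below (l + 1) m i j
  · obtain ⟨h1, h2⟩ := hb
    rw [hsum, subdiagonal_mul_apply, mul_subdiagonal_apply, if_pos (by omega),
      dif_pos (by omega)]
    by_cases hj : (j : ℕ) < m
    · rw [(ha j (by omega)).1 hj, mul_zero, zero_add]
      exact conjugator_mul_of_lt _ hj h1 i.2 ((ha _ (by omega)).2 (by omega))
    · refine (sub_eq_iff_eq_add.1 (conjugator_mul_of_le _ (by omega) h2
        ((ha j (by omega)).2 (by omega))).symm)
  · rw [commutator_apply_eq_zero (fun t ht => (ha t ht).1) hC hb, hsum, left_eq_add]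
    refine sum_eq_zero fun s hs => ?_
    rw [mem_Ioc] at hs
    rw [← hy ⟨s, by omega⟩ j, hW _ _ (fun h => hb ⟨h.1.trans hs.2, hs.1.trans_le hs.2⟩), mul_zero]

/-- The conjugacy class of `canonMatrix` consists of the matrices agreeing with it off `Below`. -/
theorem conjugate_iff {n l m : ℕ} {a : ℕ → F}
    (ha : ∀ t, t < n - l - 1 → (t < m → a t = 0) ∧ (m ≤ t → a t ≠ 0))
    (B : Matrix (Fin n) (Fin n) F) :
    (∃ C, IsUnitriangular C ∧ C⁻¹ * canonMatrix n l a * C = B) ↔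
      ∀ i j : Fin n, ¬ Below (l + 1) m i j → B i j = canonMatrix n l a i j := by
  constructor
  · rintro ⟨C, hC, h⟩ i j hij
    rw [hC.inv_mul_mul_eq_iff] at h
    rw [← sub_eq_zero, ← Matrix.sub_apply]
    refine apply_eq_zero_of_unitriangular_mul hC (fun i j hij => ?_) i j hij
    rw [Matrix.mul_sub, ← h, canonMatrix_eq, Matrix.add_mul, Matrix.mul_add, Matrix.one_mul,
      Matrix.mul_one, add_sub_add_left_eq_sub, Matrix.sub_apply,
      commutator_apply_eq_zero (fun t ht => (ha t ht).1) hC hij, sub_self]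
  · intro h
    obtain ⟨C, hC, hCW⟩ := exists_conjugator ha (W := B - canonMatrix n l a)
      fun i j hij => by rw [Matrix.sub_apply, h i j hij, sub_self]
    refine ⟨C, hC, hC.inv_mul_mul_eq_iff.2 ?_⟩
    rw [canonMatrix_eq, Matrix.add_mul, hCW, canonMatrix_eq, Matrix.one_mul]
    noncomm_ring

theorem sum_range_ite_le (N m : ℕ) :
    ∑ r ∈ range N, (if m ≤ r then r else 0) = N * (N - 1) / 2 - m * (m - 1) / 2 := by
  simp only [← sum_range_id]
  rw [← sum_filter]
  rcases le_total m N with h | h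
  · have : {r ∈ range N | m ≤ r} = Ico m N := by ext; simp [and_comm]
    rw [this]
    exact Nat.eq_sub_of_add_eq' (sum_range_add_sum_Ico (fun r => r) h)
  · rw [Nat.sub_eq_zero_of_le (sum_le_sum_of_subset (range_subset_range.2 h))]
    refine sum_eq_zero fun r hr => ?_
    rw [mem_filter, mem_range] at hr
    omega

theorem sum_card_below {n k : ℕ} (hk : k ≤ n) (m : ℕ) :
    ∑ i : Fin n, #{j : Fin n | Below k m i j} = (n - k) * (n - k - 1) / 2 - m * (m - 1) / 2 := by
  have hcard : ∀ i : Fin n, #{j : Fin n | Below k m i j}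
      = if m + k ≤ (i : ℕ) then (i : ℕ) - k else 0 := by
    intro i
    split_ifs with h
    · refine (congrArg card (filter_congr (q := fun j : Fin n => (j : ℕ) < i - k)
        fun j _ => ?_)).trans ?_
      · simp only [Below]
        omega
      · rw [Fin.card_filter_val_lt]
        omega
    · rw [card_eq_zero, filter_eq_empty_iff]
      exact fun j _ hj => h hj.1
  obtain ⟨N, rfl⟩ := Nat.exists_eq_add_of_le hk
  simp only [hcard]
  rw [Fin.sum_univ_eq_sum_range (fun i => if m + k ≤ i then i - k else 0), sum_range_add,
    Nat.add_sub_cancel_left, ← sum_range_ite_le, sum_eq_zero, zero_add]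
  · refine sum_congr rfl fun r _ => ?_
    rw [Nat.add_sub_cancel_left, add_comm m k]
    simp only [add_le_add_iff_left]
  · intro i hi
    rw [mem_range] at hi
    rw [if_neg (by omega)]

theorem ncard_agree_off {ι κ α : Type*} [Fintype ι] [Fintype κ] [DecidableEq ι] [DecidableEq κ]
    [Fintype α] (P : ι → κ → Prop) [∀ i j, Decidable (P i j)] (A : Matrix ι κ α) :
    Set.ncard {B : Matrix ι κ α | ∀ i j, ¬ P i j → B i j = A i j}
      = Fintype.card α ^ ∑ i, #{j | P i j} := by
  let S : Finset (ι → κ → α) := Fintype.piFinset fun i => Fintype.piFinset fun j =>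
    if P i j then univ else {A i j}
  have hS : {B : Matrix ι κ α | ∀ i j, ¬ P i j → B i j = A i j} = (S : Set (ι → κ → α)) := by
    refine Set.ext fun B => Iff.symm <| Fintype.mem_piFinset.trans <| forall_congr' fun i =>
      Fintype.mem_piFinset.trans <| forall_congr' fun j => ?_
    by_cases h : P i j <;> simp [h]
  rw [hS]
  refine (Set.ncard_coe_finset S).trans ?_
  simp only [S, Fintype.card_piFinset, apply_ite card, card_singleton, card_univ, prod_ite,
    prod_const, one_pow, mul_one, prod_pow_eq_pow_sum]

end pPowerPaper

theorem pPowerPaper.stmt8 (q : ℕ) (F : Type*) [Field F] [Fintype F] (hF : Fintype.card F = q)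
    (n l m : ℕ) (hn : 0 < n) (hl : l ≤ n - 2) (hm : m ≤ (n - l - 1) / 2 + 1)
    (a : ℕ → F) (ha : ∀ t, t < n - l - 1 → (t < m → a t = 0) ∧ (m ≤ t → a t ≠ 0)) :
    Set.ncard {B : Matrix (Fin n) (Fin n) F |
        ∃ C, IsUnitriangular C ∧ C⁻¹ * canonMatrix n l a * C = B}
      = q ^ ((n - l - 1) * (n - l - 2) / 2 - m * (m - 1) / 2) ∧
    ∀ a' : ℕ → F, (∀ t, t < n - l - 1 → (t < m → a' t = 0) ∧ (m ≤ t → a' t ≠ 0)) →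
      canonMatrix n l a ≠ canonMatrix n l a' →
      ¬ ∃ C : Matrix (Fin n) (Fin n) F,
          IsUnitriangular C ∧ C⁻¹ * canonMatrix n l a * C = canonMatrix n l a' := by
  constructor
  · simp only [conjugate_iff ha]
    rw [ncard_agree_off (fun i j : Fin n => Below (l + 1) m i j), sum_card_below (by omega), hF,
      Nat.sub_sub n (l + 1) 1, Nat.sub_sub n l 1, Nat.sub_sub n l 2]
  · intro a' _ hne h
    rw [conjugate_iff ha] at h
    refine hne (Matrix.ext fun i j => ?_)
    by_cases hij : Below (l + 1) m i j
    · have h2 := hij.2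
      have hne' : i ≠ j := fun e => by
        subst e
        omega
      rw [canonMatrix, canonMatrix, if_neg hne', if_neg hne', if_neg (by omega),
        if_neg (by omega)]
    · exact (h i j hij).symm
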